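/- Let p be an odd prime and r an integer with r ≥ 2. Then Σ_{k=1}^{(p^r−1)/2} G(p^r, k) ≡ 0 (mod p^{r+2}), where G(n,k) = ((−1)^{n+k} / 4^{5n−4−k}) · n · C(2n−1, n−1) · C(2(2n−1+k), 2n−1+k) · C(2n−1+k, 2k) · C(2n−1−k, n−1) / C(2k,k). -/

import Mathlib

open Finset

/-- `a ≡ b (mod p^m)` for rationals: the `p`-adic valuation of `a - b` is at least `m`. -/
def pcong (p m : ℕ) (a b : ℚ) : Prop :=
  a = b ∨ (m : ℤ) ≤ padicValRat p (a - b)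

/-- \`G(n,k) = ((−1)^{n+k}/4^{5n−4−k}) · n · C(2n−1,n−1) · C(2(2n−1+k),2n−1+k) · C(2n−1+k,2k) · C(2n−1−k,n−1) / C(2k,k)\`. -/
def G (n k : ℕ) : ℚ :=
  (-1) ^ (n + k) / 4 ^ (5 * n - 4 - k) * (n : ℚ) * (((2 * n - 1).choose (n - 1) : ℕ) : ℚ) *
    (((2 * (2 * n - 1 + k)).choose (2 * n - 1 + k) : ℕ) : ℚ) *
    (((2 * n - 1 + k).choose (2 * k) : ℕ) : ℚ) *
    (((2 * n - 1 - k).choose (n - 1) : ℕ) : ℚ) / (((2 * k).choose k : ℕ) : ℚ)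

/-- The congruence to zero modulo `p ^ m` is stable under addition. -/
theorem pcong_zero_add {p m : ℕ} [Fact p.Prime] {a b : ℚ} (ha : pcong p m a 0)
    (hb : pcong p m b 0) : pcong p m (a + b) 0 := by
  unfold pcong at *
  simp only [sub_zero] at *
  by_cases hab : a + b = 0
  · exact Or.inl hab
  rcases ha with rfl | ha
  · simpa using hb
  rcases hb with rfl | hb
  · simpa using Or.inr ha
  · exact Or.inr ((le_min ha hb).trans (padicValRat.min_le_padicValRat_add hab))

/-- Adding a multiple of `p ^ r` to `j` with `2 j < p ^ r` does not lower the `p`-adic valuation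
of the central binomial coefficient. -/
theorem padicValNat_choose_two_mul_le_add_mul {p : ℕ} [Fact p.Prime] {r j : ℕ} (c : ℕ)
    (hj : 2 * j < p ^ r) :
    padicValNat p ((2 * j).choose j) ≤
      padicValNat p ((2 * (c * p ^ r + j)).choose (c * p ^ r + j)) := by
  have hlog : Nat.log p (2 * j) ≤ Nat.log p (2 * (c * p ^ r + j)) :=
    Nat.log_mono_right (by nlinarith [Nat.zero_le (c * p ^ r)])
  rw [padicValNat_choose (by omega) (Nat.lt_succ_of_le hlog),
    padicValNat_choose (by omega) (Nat.lt_succ_self _)]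
  refine Finset.card_le_card fun i hi => ?_
  simp only [Finset.mem_filter] at hi ⊢
  refine ⟨hi.1, ?_⟩
  have e₁ : 2 * j - j = j := by omega
  have e₂ : 2 * (c * p ^ r + j) - (c * p ^ r + j) = c * p ^ r + j := by omega
  rw [e₁] at hi
  rw [e₂]
  have hir : i < r := by
    refine (Nat.pow_lt_pow_iff_right (Fact.out : p.Prime).one_lt).1 ?_
    have := Nat.mod_le j (p ^ i)
    omega
  have hmod : (c * p ^ r + j) % p ^ i = j % p ^ i := by
    obtain ⟨d, hd⟩ := (pow_dvd_pow p hir.le).mul_left c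
    rw [hd, Nat.mul_add_mod]
  rw [hmod]
  exact hi.2

/-- A positive integer below `p ^ r` has `p`-adic valuation below `r`. -/
theorem padicValNat_lt_of_lt_pow {p : ℕ} [Fact p.Prime] {r k : ℕ} (hk : 0 < k)
    (hkr : k < p ^ r) : padicValNat p k < r := by
  refine (Nat.pow_lt_pow_iff_right (Fact.out : p.Prime).one_lt).1 ?_
  exact (Nat.le_of_dvd hk pow_padicValNat_dvd).trans_lt hkr

theorem padicValNat_mul_pow_sub_le {p : ℕ} [Fact p.Prime] {r c k : ℕ} (hk : 0 < k)
    (hkr : k < p ^ r) (hc : 0 < c) : padicValNat p (c * p ^ r - k) ≤ padicValNat p k := by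
  by_contra! h
  set s := padicValNat p k + 1 with hs
  have hsr : s ≤ r := padicValNat_lt_of_lt_pow hk hkr
  have h₁ : p ^ s ∣ c * p ^ r - k := (pow_dvd_pow p h).trans pow_padicValNat_dvd
  have h₂ : p ^ s ∣ c * p ^ r := (pow_dvd_pow p hsr).mul_left c
  have hle : k ≤ c * p ^ r := hkr.le.trans (Nat.le_mul_of_pos_left _ hc)
  have h₃ : p ^ s ∣ k := by
    have := Nat.dvd_sub h₂ h₁
    rwa [Nat.sub_sub_self hle] at this
  exact pow_succ_padicValNat_not_dvd hk.ne' h₃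

theorem two_mul_sub_mul_choose {n k : ℕ} (hn : 0 < n) (hk : k < n) :
    (2 * n - k) * (2 * n - 1 - k).choose (n - 1) = n * (2 * n - k).choose n := by
  obtain ⟨m, rfl⟩ : ∃ m, n = m + 1 := ⟨n - 1, by omega⟩
  obtain ⟨t, ht⟩ : ∃ t, 2 * (m + 1) - k = t + 1 := ⟨2 * m + 1 - k, by omega⟩
  have e : 2 * (m + 1) - 1 - k = t := by omega
  rw [ht, e, Nat.add_sub_cancel, mul_comm (m + 1)]
  exact Nat.add_one_mul_choose_eq t m

/-- The product of `2 k + 1`, the `k`-th central binomial coefficient and `C(m + k + 1, 2 k + 2)`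
exhibits a factor of `m + 1`. -/
theorem two_mul_add_one_mul_choose_mul_choose {m k : ℕ} (hk : k + 1 ≤ m) :
    2 * ((2 * k + 1) * (2 * k).choose k * (m + k + 1).choose (2 * (k + 1))) =
      (m + 1) * (m + k + 1).choose k * m.choose (k + 1) := by
  have h₁ : (k + 1) * (2 * (k + 1)).choose (k + 1) = 2 * (2 * k + 1) * (2 * k).choose k :=
    Nat.succ_mul_centralBinom_succ k
  have h₂ : (m + k + 1).choose (2 * (k + 1)) * (2 * (k + 1)).choose (k + 1) =
      (m + k + 1).choose (k + 1) * m.choose (k + 1) := by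
    rw [Nat.choose_mul (by omega)]
    congr 2 <;> omega
  have h₃ : (m + k + 1).choose (k + 1) * (k + 1) = (m + k + 1).choose k * (m + 1) := by
    rw [Nat.choose_succ_right_eq]
    congr 1
    omega
  linear_combination (m + k + 1).choose (2 * (k + 1)) * (-h₁) + (k + 1) * h₂ +
    m.choose (k + 1) * h₃

/-- Every summand is divisible by `p ^ (r + 2)`. -/
theorem le_padicValRat_G {p r k : ℕ} [Fact p.Prime] (hodd : Odd p) (hk : 0 < k)
    (hkr : 2 * k < p ^ r) : ((r + 2 : ℕ) : ℤ) ≤ padicValRat p (G (p ^ r) k) := by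
  have hp : p.Prime := Fact.out
  set n := p ^ r with hn
  have hv4 : padicValRat p ((-1) ^ (n + k) / 4 ^ (5 * n - 4 - k) : ℚ) = 0 := by
    have h4 : padicValRat p (4 : ℚ) = 0 := by
      have : padicValNat p 4 = 0 := by
        refine padicValNat.eq_zero_of_not_dvd fun h => ?_
        have h2 : p ∣ 2 := hp.dvd_of_dvd_pow (n := 2) (by norm_num; exact h)
        rw [(Nat.prime_dvd_prime_iff_eq hp Nat.prime_two).1 h2] at hodd
        exact absurd hodd (by decide)
      exact_mod_cast congrArg (Nat.cast : ℕ → ℤ) this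
    rw [padicValRat.div (by positivity) (by positivity), padicValRat.pow, padicValRat.pow, h4,
      padicValRat.neg, padicValRat.one]
    simp
  have hvn : padicValNat p n = r := by rw [hn, padicValNat.prime_pow]
  have c₁ : (2 * n - 1).choose (n - 1) ≠ 0 := (Nat.choose_pos (by omega)).ne'
  have c₂ : (2 * (2 * n - 1 + k)).choose (2 * n - 1 + k) ≠ 0 := (Nat.choose_pos (by omega)).ne'
  have c₃ : (2 * n - 1 + k).choose (2 * k) ≠ 0 := (Nat.choose_pos (by omega)).ne'
  have c₄ : (2 * n - 1 - k).choose (n - 1) ≠ 0 := (Nat.choose_pos (by omega)).ne'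
  have c₅ : (2 * k).choose k ≠ 0 := (Nat.choose_pos (by omega)).ne'
  have hn0 : n ≠ 0 := by omega
  have hG : padicValRat p (G n k) = (r : ℤ) + padicValNat p ((2 * n - 1).choose (n - 1)) +
      padicValNat p ((2 * (2 * n - 1 + k)).choose (2 * n - 1 + k)) +
      padicValNat p ((2 * n - 1 + k).choose (2 * k)) +
      padicValNat p ((2 * n - 1 - k).choose (n - 1)) - padicValNat p ((2 * k).choose k) := by
    have q₀ : ((-1) ^ (n + k) / 4 ^ (5 * n - 4 - k) : ℚ) ≠ 0 := by positivity
    have qn : (n : ℚ) ≠ 0 := Nat.cast_ne_zero.2 hn0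
    have q₁ := Nat.cast_ne_zero (R := ℚ).2 c₁
    have q₂ := Nat.cast_ne_zero (R := ℚ).2 c₂
    have q₃ := Nat.cast_ne_zero (R := ℚ).2 c₃
    have q₄ := Nat.cast_ne_zero (R := ℚ).2 c₄
    have q₅ := Nat.cast_ne_zero (R := ℚ).2 c₅
    unfold G
    rw [padicValRat.div (by simp only [ne_eq, mul_eq_zero]; tauto) q₅,
      padicValRat.mul (by simp only [ne_eq, mul_eq_zero]; tauto) q₄,
      padicValRat.mul (by simp only [ne_eq, mul_eq_zero]; tauto) q₃,
      padicValRat.mul (by simp only [ne_eq, mul_eq_zero]; tauto) q₂,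
      padicValRat.mul (by simp only [ne_eq, mul_eq_zero]; tauto) q₁,
      padicValRat.mul q₀ qn, hv4]
    simp only [padicValRat.of_nat, hvn, zero_add]
  have hden : padicValNat p ((2 * k).choose k) < r := by
    have h := Nat.factorization_choose_le_log (p := p) (n := 2 * k) (k := k)
    rw [Nat.factorization_def _ hp] at h
    exact h.trans_lt (Nat.log_lt_of_lt_pow (by omega) hkr)
  have hlast : r ≤ padicValNat p k + padicValNat p ((2 * n - 1 - k).choose (n - 1)) := by
    have h := congrArg (padicValNat p) (two_mul_sub_mul_choose (n := n) (k := k) (by omega)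
      (by omega))
    rw [padicValNat.mul (by omega) c₄, padicValNat.mul hn0 (Nat.choose_pos (by omega)).ne', hvn]
      at h
    have := padicValNat_mul_pow_sub_le (p := p) (r := r) (c := 2) hk (by omega) two_pos
    rw [← hn] at this
    omega
  have hmid : r ≤ padicValNat p (2 * k - 1) +
      padicValNat p ((2 * (2 * n - 1 + k)).choose (2 * n - 1 + k)) +
      padicValNat p ((2 * n - 1 + k).choose (2 * k)) := by
    obtain ⟨j, rfl⟩ : ∃ j, k = j + 1 := ⟨k - 1, by omega⟩
    have h := two_mul_add_one_mul_choose_mul_choose (m := 2 * n - 1) (k := j) (by omega)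
    have hj := padicValNat_choose_two_mul_le_add_mul (p := p) (r := r) (j := j) 2 (by omega)
    rw [← hn, show 2 * n + j = 2 * n - 1 + (j + 1) by omega] at hj
    rw [show 2 * n - 1 + 1 = 2 * n by omega, mul_assoc (2 * n),
      mul_assoc 2 n] at h
    replace h := congrArg (padicValNat p) (Nat.eq_of_mul_eq_mul_left two_pos h)
    have c₆ : (2 * j).choose j ≠ 0 := (Nat.choose_pos (by omega)).ne'
    have c₇ : (2 * n - 1 + j + 1).choose j ≠ 0 := (Nat.choose_pos (by omega)).ne'
    have c₈ : (2 * n - 1).choose (j + 1) ≠ 0 := (Nat.choose_pos (by omega)).ne'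
    rw [← add_assoc] at c₃
    rw [padicValNat.mul (by positivity) c₃, padicValNat.mul (by omega) c₆,
      padicValNat.mul hn0 (mul_ne_zero c₇ c₈), hvn] at h
    rw [show 2 * (j + 1) - 1 = 2 * j + 1 by omega]
    rw [← add_assoc (2 * n - 1) j 1] at hj ⊢
    omega
  have hsum : padicValNat p k + padicValNat p (2 * k - 1) < r := by
    have h₁ := padicValNat_lt_of_lt_pow (p := p) (r := r) hk (by omega)
    have h₂ := padicValNat_lt_of_lt_pow (p := p) (r := r) (k := 2 * k - 1) (by omega) (by omega)
    by_cases hpk : p ∣ k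
    · have : ¬ p ∣ 2 * k - 1 := fun h => by
        have h' := Nat.dvd_sub (hpk.mul_left 2) h
        rw [Nat.sub_sub_self (by omega)] at h'
        exact hp.one_lt.ne' (Nat.dvd_one.1 h')
      rw [padicValNat.eq_zero_of_not_dvd this]
      omega
    · rw [padicValNat.eq_zero_of_not_dvd hpk]
      omega
  rw [hG]
  omega

theorem stmt_17 (p : ℕ) (hp : p.Prime) (hodd : Odd p) (r : ℕ) (hr : 2 ≤ r) :
    pcong p (r + 2) (∑ k ∈ Icc 1 ((p ^ r - 1) / 2), G (p ^ r) k) 0 := by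
  have : Fact p.Prime := ⟨hp⟩
  refine Finset.sum_induction _ (fun a => pcong p (r + 2) a 0) (fun _ _ => pcong_zero_add)
    (Or.inl rfl) fun k hk => Or.inr ?_
  rw [sub_zero]
  rw [Finset.mem_Icc] at hk
  exact le_padicValRat_G hodd hk.1 (by omega)
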